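/- arXiv:1912.02515 — 3 statements merged into one kernel-verified Lean document; each statement's English description precedes it below -/
import Mathlib

section
/- There exists a Rado simplicial complex; that is, there exists a countable simplicial complex which is both universal and homogeneous. -/
/-- An (abstract) simplicial complex with vertices drawn from `ℕ`:
a set of nonempty finite subsets of `ℕ` (the simplexes) closed under
passing to nonempty subsets.  The vertex set `V(X)` is the set of `v`
with `{v}` a simplex. -/
structure SComplex where
  faces : Set (Finset ℕ)
  nonempty_of_mem : ∀ s ∈ faces, s.Nonempty
  down_closed : ∀ s ∈ faces, ∀ t ⊆ s, t.Nonempty → t ∈ faces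

namespace SComplex

/-- The vertex set of a simplicial complex. -/
def vertexSet (X : SComplex) : Set ℕ := {v | {v} ∈ X.faces}

/-- The subcomplex of `X` induced on a set `U` of vertices. -/
def induced (X : SComplex) (U : Set ℕ) : SComplex where
  faces := {s | s ∈ X.faces ∧ (↑s : Set ℕ) ⊆ U}
  nonempty_of_mem := fun s hs => X.nonempty_of_mem s hs.1
  down_closed := fun s hs t hts ht =>
    ⟨X.down_closed s hs.1 t hts ht,
     fun x hx => hs.2 (Finset.mem_coe.mpr (hts (Finset.mem_coe.mp hx)))⟩

/-- The link of a vertex `v`: all simplexes `σ` with `v ∉ σ` and `σ ∪ {v}` a simplex. -/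
def link (X : SComplex) (v : ℕ) : SComplex where
  faces := {s | s ∈ X.faces ∧ v ∉ s ∧ insert v s ∈ X.faces}
  nonempty_of_mem := fun s hs => X.nonempty_of_mem s hs.1
  down_closed := fun s hs t hts ht =>
    ⟨X.down_closed s hs.1 t hts ht,
     fun hv => hs.2.1 (hts hv),
     X.down_closed _ hs.2.2 _ (Finset.insert_subset_insert v hts)
       (Finset.insert_nonempty v t)⟩

/-- `IsIso X Y f` : the map `f` is an isomorphism of simplicial complexes from `X` to `Y`,
i.e. a bijection of the vertex sets which induces a bijection between the sets of simplexes. -/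
def IsIso (X Y : SComplex) (f : ℕ → ℕ) : Prop :=
  Set.BijOn f X.vertexSet Y.vertexSet ∧
    ∀ s : Finset ℕ, (↑s : Set ℕ) ⊆ X.vertexSet → (s ∈ X.faces ↔ s.image f ∈ Y.faces)

/-- Two simplicial complexes are isomorphic. -/
def Isomorphic (X Y : SComplex) : Prop := ∃ f, IsIso X Y f

/-- `X` is universal: every countable simplicial complex is isomorphic to an induced
subcomplex of `X`. -/
def Universal (X : SComplex) : Prop :=
  ∀ Y : SComplex, Y.vertexSet.Countable →
    ∃ U ⊆ X.vertexSet, Isomorphic Y (X.induced U)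

/-- `X` is homogeneous: every isomorphism between finite induced subcomplexes of `X`
extends to an isomorphism of `X` onto itself. -/
def Homogeneous (X : SComplex) : Prop :=
  ∀ U U' : Set ℕ, U.Finite → U'.Finite → U ⊆ X.vertexSet → U' ⊆ X.vertexSet →
    ∀ f : ℕ → ℕ, IsIso (X.induced U) (X.induced U') f →
      ∃ F : ℕ → ℕ, IsIso X X F ∧ Set.EqOn F f U

/-- A Rado complex: a countable simplicial complex which is universal and homogeneous. -/
def IsRado (X : SComplex) : Prop :=
  X.vertexSet.Countable ∧ Universal X ∧ Homogeneous X

/-- The ampleness condition: for every finite `U ⊆ V(X)` and every subcomplex `A` of the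
induced complex `X_U` there is a vertex `v ∈ V(X) - U` with `Lk_X(v) ∩ X_U = A`. -/
def AmpleProp (X : SComplex) : Prop :=
  ∀ U : Set ℕ, U.Finite → U ⊆ X.vertexSet →
    ∀ A : SComplex, A.faces ⊆ (X.induced U).faces →
      ∃ v ∈ X.vertexSet \ U, (X.link v).faces ∩ (X.induced U).faces = A.faces

/-- An ample complex: a countable simplicial complex satisfying the ampleness condition. -/
def IsAmple (X : SComplex) : Prop := X.vertexSet.Countable ∧ AmpleProp X

/-- `L'` is an induced subcomplex of `L`. -/
def IsInduced (L' L : SComplex) : Prop :=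
  L'.faces ⊆ L.faces ∧ ∀ s ∈ L.faces, (↑s : Set ℕ) ⊆ L'.vertexSet → s ∈ L'.faces

end SComplex

namespace SComplex

/-- A set of pairs of vertices is a partial isomorphism from `Y` to `X` if it is the graph of an
injective partial function which preserves and reflects simplexes. -/
def IsPartialIso (Y X : SComplex) (R : Set (ℕ × ℕ)) : Prop :=
  (∀ a ∈ R, ∀ b ∈ R, a.1 = b.1 ↔ a.2 = b.2) ∧
    ∀ p : Finset (ℕ × ℕ), (↑p : Set (ℕ × ℕ)) ⊆ R →
      (p.image Prod.fst ∈ Y.faces ↔ p.image Prod.snd ∈ X.faces)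

/-- The extension property: every subcomplex of a finite set of vertices is the trace of the link
of some new vertex. -/
def HasExtension (X : SComplex) : Prop :=
  ∀ (U : Finset ℕ) (A : SComplex), A.faces ⊆ X.faces → (∀ s ∈ A.faces, s ⊆ U) →
    ∃ v ∉ U, ∀ s ⊆ U, s.Nonempty → (insert v s ∈ X.faces ↔ s ∈ A.faces)

/-- The finite partial isomorphisms from `Y` to `X`, ordered by inclusion. -/
abbrev FinPartialIso (Y X : SComplex) : Type :=
  {p : Finset (ℕ × ℕ) // IsPartialIso Y X (↑p : Set (ℕ × ℕ))}

theorem isPartialIso_empty (Y X : SComplex) : IsPartialIso Y X ∅ := by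
  refine ⟨by simp, fun p hp => ?_⟩
  have : p = ∅ := by simpa using hp
  subst this
  constructor
  · intro h
    simpa using Y.nonempty_of_mem _ h
  · intro h
    simpa using X.nonempty_of_mem _ h

theorem IsPartialIso.swap {Y X : SComplex} {R : Set (ℕ × ℕ)} (h : IsPartialIso Y X R) :
    IsPartialIso X Y (Prod.swap ⁻¹' R) := by
  refine ⟨fun a ha b hb => (h.1 _ ha _ hb).symm, fun p hp => ?_⟩
  have := h.2 (p.image Prod.swap) (by
    intro x hx
    simp only [Finset.coe_image, Set.mem_image] at hx
    obtain ⟨y, hy, rfl⟩ := hx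
    exact hp hy)
  rw [Finset.image_image, Finset.image_image] at this
  exact this.symm

theorem IsPartialIso.exists_insert {Y X : SComplex} (hX : X.vertexSet = Set.univ)
    (hE : X.HasExtension) {p : Finset (ℕ × ℕ)} (hp : IsPartialIso Y X (↑p : Set (ℕ × ℕ)))
    {a : ℕ} (ha : a ∈ Y.vertexSet) :
    ∃ v, IsPartialIso Y X (↑(insert (a, v) p) : Set (ℕ × ℕ)) := by
  classical
  by_cases hmem : ∃ v, (a, v) ∈ p
  · obtain ⟨v, hv⟩ := hmem
    exact ⟨v, by rwa [Finset.insert_eq_of_mem hv]⟩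
  push Not at hmem
  have hpre : ∀ s ⊆ p.image Prod.snd,
      (p.filter fun x => x.2 ∈ s).image Prod.snd = s := by
    intro s hs
    ext y
    simp only [Finset.mem_image, Finset.mem_filter]
    constructor
    · rintro ⟨x, hx, rfl⟩
      exact hx.2
    · intro hy
      obtain ⟨x, hx, rfl⟩ := Finset.mem_image.1 (hs hy)
      exact ⟨x, ⟨hx, hy⟩, rfl⟩
  let A : SComplex :=
    { faces := {s | s ⊆ p.image Prod.snd ∧ s.Nonempty ∧
        insert a ((p.filter fun x => x.2 ∈ s).image Prod.fst) ∈ Y.faces}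
      nonempty_of_mem := fun s hs => hs.2.1
      down_closed := fun s hs t hts ht => ⟨hts.trans hs.1, ht,
        Y.down_closed _ hs.2.2 _ (Finset.insert_subset_insert _ (Finset.image_subset_image
          (Finset.monotone_filter_right _ fun x _ hx => hts hx))) (Finset.insert_nonempty _ _)⟩ }
  obtain ⟨v, hv, hvA⟩ := hE (p.image Prod.snd) A (by
    intro s hs
    rw [← hpre s hs.1]
    refine (hp.2 _ (Finset.coe_subset.2 (Finset.filter_subset _ _))).1
      (Y.down_closed _ hs.2.2 _ (Finset.subset_insert _ _) ?_)
    rw [Finset.image_nonempty, ← Finset.image_nonempty (f := Prod.snd), hpre s hs.1]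
    exact hs.2.1) (fun s hs => hs.1)
  have hv' : ∀ x ∈ p, x.2 ≠ v := fun x hx h => hv (Finset.mem_image.2 ⟨x, hx, h⟩)
  have ha' : ∀ x ∈ p, x.1 ≠ a := by
    rintro ⟨x, y⟩ hx rfl
    exact hmem y hx
  refine ⟨v, ?_, ?_⟩
  · intro x hx y hy
    rw [Finset.mem_coe, Finset.mem_insert] at hx hy
    rcases hx with rfl | hx <;> rcases hy with rfl | hy
    · simp
    · simp [(ha' y hy).symm, (hv' y hy).symm]
    · simp [ha' x hx, hv' x hx]
    · exact hp.1 x hx y hy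
  · intro q hq
    rw [Finset.coe_subset] at hq
    by_cases hav : (a, v) ∈ q
    · obtain ⟨r, hr, rfl⟩ : ∃ r, r ⊆ p ∧ insert (a, v) r = q :=
        ⟨q.erase (a, v), Finset.subset_insert_iff.1 hq, Finset.insert_erase hav⟩
      rw [Finset.image_insert, Finset.image_insert]
      rcases r.eq_empty_or_nonempty with rfl | hne
      · have h1 : {v} ∈ X.faces := by
          have : v ∈ X.vertexSet := hX ▸ Set.mem_univ v
          exact this
        have h2 : {a} ∈ Y.faces := ha
        simp [h1, h2]
      · have hrs : (p.filter fun x => x.2 ∈ r.image Prod.snd) = r := by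
          ext x
          simp only [Finset.mem_filter, Finset.mem_image]
          constructor
          · rintro ⟨hx, y, hy, hyx⟩
            have : y = x := Prod.ext ((hp.1 y (hr hy) x hx).2 hyx) hyx
            rwa [← this]
          · exact fun hx => ⟨hr hx, x, hx, rfl⟩
        rw [hvA _ (Finset.image_subset_image hr) (hne.image _)]
        change _ ↔ _ ∧ _ ∧ _
        rw [hrs]
        exact ⟨fun h => ⟨Finset.image_subset_image hr, hne.image _, h⟩, fun h => h.2.2⟩
    · exact hp.2 q (Finset.coe_subset.2 ((Finset.subset_insert_iff_of_notMem hav).1 hq))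

theorem exists_isPartialIso_of_cofinal {Y X : SComplex} {ι : Type*} [Encodable ι]
    (p : FinPartialIso Y X) (D : ι → Order.Cofinal (FinPartialIso Y X)) :
    ∃ R, IsPartialIso Y X R ∧ ↑p.1 ⊆ R ∧ ∀ i, ∃ q ∈ D i, (↑q.1 : Set (ℕ × ℕ)) ⊆ R := by
  let I := Order.idealOfCofinals p D
  let R : Set (ℕ × ℕ) := {x | ∃ q ∈ I, x ∈ q.1}
  have hsub : ∀ q ∈ I, (↑q.1 : Set (ℕ × ℕ)) ⊆ R := fun q hq x hx => ⟨q, hq, hx⟩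
  have hfin : ∀ s : Finset (ℕ × ℕ), (↑s : Set (ℕ × ℕ)) ⊆ R → ∃ q ∈ I, s ⊆ q.1 := by
    intro s
    induction s using Finset.induction_on with
    | empty => exact fun _ => ⟨p, Order.mem_idealOfCofinals p D, by simp⟩
    | insert x s _ ih =>
      intro h
      rw [Finset.coe_insert, Set.insert_subset_iff] at h
      obtain ⟨q, hq, hsq⟩ := ih h.2
      obtain ⟨r, hr, hxr⟩ := h.1
      obtain ⟨t, ht, hqt, hrt⟩ := I.directed q hq r hr
      exact ⟨t, ht, Finset.insert_subset (hrt hxr) (hsq.trans hqt)⟩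
  refine ⟨R, ⟨?_, ?_⟩, hsub p (Order.mem_idealOfCofinals p D), fun i => ?_⟩
  · intro a ha b hb
    obtain ⟨q, -, hq⟩ := hfin {a, b} (by
      simp [Set.insert_subset_iff, ha, hb])
    exact q.2.1 a (hq (by simp)) b (hq (by simp))
  · intro s hs
    obtain ⟨q, -, hq⟩ := hfin s hs
    exact q.2.2 s (Finset.coe_subset.2 hq)
  · obtain ⟨q, hq, hqI⟩ := Order.cofinal_meets_idealOfCofinals p D i
    exact ⟨q, hq, hsub q hqI⟩

/-- The finite partial isomorphisms whose domain contains `a`, if `a` is a vertex. -/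
def cofinalDomain (Y : SComplex) {X : SComplex} (hX : X.vertexSet = Set.univ)
    (hE : X.HasExtension) (a : ℕ) : Order.Cofinal (FinPartialIso Y X) where
  carrier := {p | a ∈ Y.vertexSet → ∃ v, (a, v) ∈ p.1}
  isCofinal p := by
    by_cases ha : a ∈ Y.vertexSet
    · obtain ⟨v, hv⟩ := p.2.exists_insert hX hE ha
      exact ⟨⟨_, hv⟩, fun _ => ⟨v, Finset.mem_insert_self _ _⟩, Finset.subset_insert _ _⟩
    · exact ⟨p, fun h => absurd h ha, le_rfl⟩

/-- The finite partial isomorphisms whose range contains `b`. -/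
def cofinalRange {Y : SComplex} (X : SComplex) (hY : Y.vertexSet = Set.univ)
    (hE : Y.HasExtension) (b : ℕ) : Order.Cofinal (FinPartialIso Y X) where
  carrier := {p | b ∈ X.vertexSet → ∃ v, (v, b) ∈ p.1}
  isCofinal p := by
    by_cases hb : b ∈ X.vertexSet
    · have hswap : IsPartialIso X Y (↑(p.1.image Prod.swap) : Set (ℕ × ℕ)) := by
        rw [Finset.coe_image, Set.image_swap_eq_preimage_swap]
        exact p.2.swap
      obtain ⟨v, hv⟩ := hswap.exists_insert hY hE hb
      have hvp : IsPartialIso Y X (↑(insert (v, b) p.1) : Set (ℕ × ℕ)) := by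
        convert hv.swap using 1
        ext ⟨x, y⟩
        simp [and_comm]
      exact ⟨⟨_, hvp⟩, fun _ => ⟨v, Finset.mem_insert_self _ _⟩, Finset.subset_insert _ _⟩
    · exact ⟨p, fun h => absurd h hb, le_rfl⟩

theorem IsPartialIso.exists_map {Y X : SComplex} {R : Set (ℕ × ℕ)} (h : IsPartialIso Y X R)
    (hR : ∀ a ∈ Y.vertexSet, ∃ v, (a, v) ∈ R) :
    ∃ f : ℕ → ℕ, (∀ a ∈ Y.vertexSet, (a, f a) ∈ R) ∧ Set.InjOn f Y.vertexSet ∧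
      ∀ s : Finset ℕ, (↑s : Set ℕ) ⊆ Y.vertexSet → (s ∈ Y.faces ↔ s.image f ∈ X.faces) := by
  choose! f hf using hR
  refine ⟨f, hf, fun a ha b hb hab => (h.1 _ (hf a ha) _ (hf b hb)).2 hab, fun s hs => ?_⟩
  have := h.2 (s.image fun x => (x, f x)) (by
    intro x hx
    simp only [Finset.coe_image, Set.mem_image] at hx
    obtain ⟨y, hy, rfl⟩ := hx
    exact hf y (hs hy))
  rw [Finset.image_image, Finset.image_image] at this
  simpa [Function.comp_def] using this

theorem HasExtension.universal {X : SComplex} (hX : X.vertexSet = Set.univ)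
    (hE : X.HasExtension) : X.Universal := by
  intro Y _
  obtain ⟨R, hR, -, hD⟩ := exists_isPartialIso_of_cofinal
    ⟨∅, by simpa using isPartialIso_empty Y X⟩ (cofinalDomain Y hX hE)
  obtain ⟨f, -, hinj, hface⟩ := hR.exists_map fun a ha => by
    obtain ⟨q, hq, hqR⟩ := hD a
    obtain ⟨v, hv⟩ := hq ha
    exact ⟨v, hqR hv⟩
  have hvert : (X.induced (f '' Y.vertexSet)).vertexSet = f '' Y.vertexSet := by
    ext v
    have hv : v ∈ X.vertexSet := hX ▸ Set.mem_univ v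
    change ({v} ∈ X.faces ∧ _) ↔ _
    simp [show {v} ∈ X.faces from hv]
  refine ⟨f '' Y.vertexSet, hX ▸ Set.subset_univ _, f, ?_, fun s hs => ?_⟩
  · rw [hvert]
    exact hinj.bijOn_image
  · rw [hface s hs]
    refine ⟨fun h => ⟨h, ?_⟩, fun h => h.1⟩
    rw [Finset.coe_image]
    exact Set.image_mono hs

theorem HasExtension.homogeneous {X : SComplex} (hX : X.vertexSet = Set.univ)
    (hE : X.HasExtension) : X.Homogeneous := by
  intro U U' hU _ _ _ f hf
  have hmem : ∀ v, v ∈ X.vertexSet := fun v => hX ▸ Set.mem_univ v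
  have hvert : (X.induced U).vertexSet = U := by
    ext v
    change ({v} ∈ X.faces ∧ _) ↔ _
    simp [show {v} ∈ X.faces from hmem v]
  have hinj : Set.InjOn f U := hvert ▸ hf.1.injOn
  have hmaps : ∀ x ∈ U, f x ∈ U' := by
    intro x hx
    have h : {f x} ∈ (X.induced U').faces := hf.1.mapsTo (hvert.symm ▸ hx)
    simpa using h.2
  have hgraph : IsPartialIso X X (↑(hU.toFinset.image fun x => (x, f x)) : Set (ℕ × ℕ)) := by
    have hG : ∀ x ∈ (↑(hU.toFinset.image fun x => (x, f x)) : Set (ℕ × ℕ)),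
        x.1 ∈ U ∧ x.2 = f x.1 := by
      intro x hx
      simp only [Finset.coe_image, Set.mem_image, Set.Finite.coe_toFinset] at hx
      obtain ⟨y, hy, rfl⟩ := hx
      exact ⟨hy, rfl⟩
    refine ⟨fun a ha b hb => ?_, fun p hp => ?_⟩
    · obtain ⟨ha, ha'⟩ := hG a ha
      obtain ⟨hb, hb'⟩ := hG b hb
      rw [ha', hb', hinj.eq_iff ha hb]
    · have h1 : (↑(p.image Prod.fst) : Set ℕ) ⊆ U := by
        intro x hx
        simp only [Finset.coe_image, Set.mem_image] at hx
        obtain ⟨y, hy, rfl⟩ := hx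
        exact (hG y (hp hy)).1
      have h2 : (p.image Prod.fst).image f = p.image Prod.snd := by
        rw [Finset.image_image]
        exact Finset.image_congr fun x hx => (hG x (hp hx)).2.symm
      have h3 := hf.2 (p.image Prod.fst) (hvert.symm ▸ h1)
      rw [h2] at h3
      refine ⟨fun h => (h3.1 ⟨h, h1⟩).1, fun h => (h3.2 ⟨h, ?_⟩).1⟩
      rw [← h2, Finset.coe_image]
      rintro _ ⟨x, hx, rfl⟩
      exact hmaps x (h1 hx)
  obtain ⟨R, hR, hfR, hD⟩ := exists_isPartialIso_of_cofinal ⟨_, hgraph⟩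
    (Sum.elim (cofinalDomain X hX hE) (cofinalRange X hX hE))
  obtain ⟨F, hF, hFinj, hface⟩ := hR.exists_map fun a ha => by
    obtain ⟨q, hq, hqR⟩ := hD (Sum.inl a)
    obtain ⟨v, hv⟩ := hq ha
    exact ⟨v, hqR hv⟩
  refine ⟨F, ⟨⟨fun a _ => hmem _, hFinj, fun b hb => ?_⟩, hface⟩, fun x hx => ?_⟩
  · obtain ⟨q, hq, hqR⟩ := hD (Sum.inr b)
    obtain ⟨v, hv⟩ := hq hb
    exact ⟨v, hmem v, (hR.1 _ (hF v (hmem v)) _ (hqR hv)).1 rfl⟩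
  · refine (hR.1 _ (hF x (hmem x)) (x, f x) (hfR ?_)).1 rfl
    simp [hx]

/-- An enumeration of the finite families of finite sets of vertices in which every family occurs
infinitely often. -/
def familyAt (n : ℕ) : Finset (Finset ℕ) :=
  (Encodable.decode n.unpair.1).getD ∅

theorem exists_familyAt_eq (S : Finset (Finset ℕ)) (n : ℕ) : ∃ v ≥ n, familyAt v = S :=
  ⟨Nat.pair (Encodable.encode S) n, Nat.right_le_pair _ _, by simp [familyAt]⟩

/-- The complex in which a simplex with largest vertex `v` is required to have its opposite face
in the family `familyAt v`. -/
def radoComplex : SComplex where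
  faces := {s | s.Nonempty ∧ ∀ t ⊆ s, ∀ v ∈ t, (∀ u ∈ t, u ≤ v) → (t.erase v).Nonempty →
    t.erase v ∈ familyAt v}
  nonempty_of_mem := fun _ hs => hs.1
  down_closed := fun _ hs _ hts ht => ⟨ht, fun r hr => hs.2 r (hr.trans hts)⟩

theorem vertexSet_radoComplex : radoComplex.vertexSet = Set.univ := by
  refine Set.eq_univ_of_forall fun v => ⟨Finset.singleton_nonempty v, fun t ht w hw _ hne => ?_⟩
  obtain ⟨x, hx⟩ := hne
  have hxt := Finset.mem_singleton.1 (ht (Finset.mem_of_mem_erase hx))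
  have hwt := Finset.mem_singleton.1 (ht hw)
  exact absurd (hxt.trans hwt.symm) (Finset.ne_of_mem_erase hx)

theorem hasExtension_radoComplex : radoComplex.HasExtension := by
  classical
  intro U A hA hAU
  obtain ⟨v, hv, hvA⟩ := exists_familyAt_eq (U.powerset.filter (· ∈ A.faces)) (U.sup id + 1)
  have hlt : ∀ u ∈ U, u < v := fun u hu =>
    Nat.lt_of_lt_of_le (Nat.lt_succ_of_le (Finset.le_sup (f := id) hu)) hv
  refine ⟨v, fun h => lt_irrefl v (hlt v h), fun s hs hne => ?_⟩
  have hvs : v ∉ s := fun h => lt_irrefl v (hlt v (hs h))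
  constructor
  · intro h
    have := h.2 _ subset_rfl v (Finset.mem_insert_self v s) (fun u hu => by
      rcases Finset.mem_insert.1 hu with rfl | hu
      · exact le_rfl
      · exact (hlt u (hs hu)).le) (by rwa [Finset.erase_insert hvs])
    rw [Finset.erase_insert hvs, hvA] at this
    exact (Finset.mem_filter.1 this).2
  · intro h
    refine ⟨Finset.insert_nonempty v s, fun t ht w hw hmax hne' => ?_⟩
    by_cases hvt : v ∈ t
    · have hwv : w = v := by
        rcases Finset.mem_insert.1 (ht hw) with h' | h'
        · exact h'
        · exact absurd (hmax v hvt) (not_le.2 (hlt w (hs h')))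
      subst hwv
      have hts : t.erase w ⊆ s := Finset.subset_insert_iff.1 ht
      rw [hvA]
      exact Finset.mem_filter.2 ⟨Finset.mem_powerset.2 (hts.trans hs),
        A.down_closed s h _ hts hne'⟩
    · exact (hA h).2 t ((Finset.subset_insert_iff_of_notMem hvt).1 ht) w hw hmax hne'

end SComplex

/-- There exists a Rado simplicial complex: a countable simplicial
complex which is both universal and homogeneous. -/
theorem exists_rado_complex :
    ∃ X : SComplex, X.vertexSet.Countable ∧ X.Universal ∧ X.Homogeneous := by
  exact ⟨SComplex.radoComplex, Set.to_countable _,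
    SComplex.hasExtension_radoComplex.universal SComplex.vertexSet_radoComplex,
    SComplex.hasExtension_radoComplex.homogeneous SComplex.vertexSet_radoComplex⟩
end

section
/- Every ample simplicial complex is universal: if X is ample, then every countable simplicial complex is isomorphic to an induced subcomplex of X. -/
namespace SComplex

/-- `f` embeds the vertices in `D` of `Y` into `X` so that simplexes are preserved and
reflected. -/
def EmbedsOn (Y X : SComplex) (D : Set ℕ) (f : ℕ → ℕ) : Prop :=
  Set.InjOn f D ∧ ∀ s : Finset ℕ, (↑s : Set ℕ) ⊆ D → (s ∈ Y.faces ↔ s.image f ∈ X.faces)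

lemma EmbedsOn.congr {Y X : SComplex} {D : Set ℕ} {f g : ℕ → ℕ} (hf : EmbedsOn Y X D f)
    (hfg : Set.EqOn f g D) : EmbedsOn Y X D g := by
  refine ⟨hf.1.congr hfg, fun s hs => ?_⟩
  rw [hf.2 s hs, Finset.image_congr fun x hx => hfg (hs hx)]

lemma EmbedsOn.mapsTo {Y X : SComplex} {D : Set ℕ} {f : ℕ → ℕ} (hf : EmbedsOn Y X D f)
    (hD : D ⊆ Y.vertexSet) : Set.MapsTo f D X.vertexSet := by
  intro x hx
  simpa [vertexSet] using (hf.2 {x} (by simpa using hx)).1 (hD hx)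

/-- The image under `f` of the part on `D` of the link of `n` in `Y`. -/
def linkImage (Y : SComplex) (D : Set ℕ) (n : ℕ) (f : ℕ → ℕ) : SComplex where
  faces := {t | ∃ s ∈ ((Y.link n).induced D).faces, s.image f = t}
  nonempty_of_mem := by
    rintro _ ⟨s, hs, rfl⟩
    exact (((Y.link n).induced D).nonempty_of_mem s hs).image f
  down_closed := by
    rintro _ ⟨s, hs, rfl⟩ t hts ht
    obtain ⟨r, hrs, rfl⟩ := Finset.subset_image_iff.1 hts
    exact ⟨r, ((Y.link n).induced D).down_closed s hs r (by exact_mod_cast hrs)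
      (Finset.image_nonempty.1 ht), rfl⟩

/-- In an ample complex a finite partial embedding extends to one further vertex. -/
lemma EmbedsOn.exists_extend {Y X : SComplex} (hX : X.AmpleProp) {D : Set ℕ} (hfin : D.Finite)
    (hD : D ⊆ Y.vertexSet) {f : ℕ → ℕ} (hf : EmbedsOn Y X D f) {n : ℕ} (hn : n ∈ Y.vertexSet)
    (hnD : n ∉ D) : ∃ g, EmbedsOn Y X (insert n D) g ∧ Set.EqOn f g D := by
  classical
  obtain ⟨v, ⟨hvX, hvU⟩, hlink⟩ := hX (f '' D) (hfin.image f) (hf.mapsTo hD).image_subset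
    (linkImage Y D n f) (by
      rintro _ ⟨s, ⟨hs, hsD⟩, rfl⟩
      exact ⟨(hf.2 s hsD).1 hs.1, by rw [Finset.coe_image]; exact Set.image_mono hsD⟩)
  have hfg : Set.EqOn f (Function.update f n v) D := fun x hx => by
    rw [Function.update_of_ne (ne_of_mem_of_not_mem hx hnD)]
  refine ⟨Function.update f n v, ⟨?_, fun s hs => ?_⟩, hfg⟩
  · rw [Set.injOn_insert hnD, ← hfg.image_eq]
    exact ⟨hf.1.congr hfg, by simpa using hvU⟩
  · by_cases hns : n ∈ s
    · obtain ⟨r, hnr, rfl⟩ : ∃ r, n ∉ r ∧ insert n r = s :=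
        ⟨s.erase n, Finset.notMem_erase n s, Finset.insert_erase hns⟩
      have hrD : (↑r : Set ℕ) ⊆ D := fun x hx =>
        (hs (Finset.mem_coe.2 (Finset.mem_insert_of_mem hx))).resolve_left
          (ne_of_mem_of_not_mem hx hnr)
      rw [Finset.image_insert, Function.update_self,
        ← Finset.image_congr fun x hx => hfg (hrD hx)]
      rcases r.eq_empty_or_nonempty with rfl | hr
      · simpa [vertexSet] using iff_of_true hn hvX
      · have hsub : (↑(r.image f) : Set ℕ) ⊆ f '' D := by
          rw [Finset.coe_image]; exact Set.image_mono hrD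
        have key := Set.ext_iff.1 hlink (r.image f)
        constructor
        · intro h
          have hrY : r ∈ Y.faces := Y.down_closed _ h r (Finset.subset_insert n r) hr
          exact (key.2 ⟨r, ⟨⟨hrY, hnr, h⟩, hrD⟩, rfl⟩).1.2.2
        · intro h
          have hrX : r.image f ∈ X.faces :=
            X.down_closed _ h _ (Finset.subset_insert _ _) (hr.image f)
          obtain ⟨t, ⟨ht, htD⟩, htr⟩ := key.1 ⟨⟨hrX, fun hv => hvU (hsub hv), h⟩, hrX, hsub⟩
          have : t = r := by
            rw [← Finset.coe_inj, ← hf.1.image_eq_image_iff htD hrD]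
            exact_mod_cast congrArg (fun u : Finset ℕ => (↑u : Set ℕ)) htr
          exact this ▸ ht.2.2
    · have hsD : (↑s : Set ℕ) ⊆ D := fun x hx =>
        (hs hx).resolve_left (ne_of_mem_of_not_mem hx hns)
      rw [hf.2 s hsD, Finset.image_congr fun x hx => hfg (hsD hx)]

/-- Every complex embeds on all its vertices into an ample complex. -/
lemma exists_embedsOn_vertexSet {X : SComplex} (hX : X.AmpleProp) (Y : SComplex) :
    ∃ f, EmbedsOn Y X Y.vertexSet f := by
  have step (n : ℕ) (f : ℕ → ℕ) (hf : EmbedsOn Y X (Y.vertexSet ∩ Set.Iio n) f) :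
      ∃ g, EmbedsOn Y X (Y.vertexSet ∩ Set.Iio (n + 1)) g ∧
        Set.EqOn f g (Y.vertexSet ∩ Set.Iio n) := by
    have hIio : Set.Iio (n + 1) = insert n (Set.Iio n) := by
      ext; simp only [Set.mem_Iio, Set.mem_insert_iff]; omega
    rw [hIio]
    by_cases hn : n ∈ Y.vertexSet
    · rw [Set.inter_insert_of_mem hn]
      exact hf.exists_extend hX ((Set.finite_Iio n).inter_of_right _) Set.inter_subset_left hn
        (by simp)
    · rw [Set.inter_insert_of_notMem hn]
      exact ⟨f, hf, Set.eqOn_refl f _⟩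
  have base : EmbedsOn Y X (Y.vertexSet ∩ Set.Iio 0) id := by
    refine ⟨Function.injective_id.injOn, fun s hs => ?_⟩
    obtain rfl : s = ∅ := by
      rw [← Finset.coe_eq_empty, ← Set.subset_empty_iff]
      exact hs.trans fun x hx => absurd hx.2 (Nat.not_lt_zero x)
    rw [Finset.image_empty]
    exact iff_of_false (fun h => Finset.not_nonempty_empty (Y.nonempty_of_mem _ h))
      fun h => Finset.not_nonempty_empty (X.nonempty_of_mem _ h)
  choose next hnext heq using step
  let G (n : ℕ) : {f // EmbedsOn Y X (Y.vertexSet ∩ Set.Iio n) f} :=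
    Nat.rec ⟨id, base⟩ (fun n f => ⟨next n f.1 f.2, hnext n f.1 f.2⟩) n
  have hG (n : ℕ) : Set.EqOn (G n).1 (G (n + 1)).1 (Y.vertexSet ∩ Set.Iio n) :=
    heq n (G n).1 (G n).2
  have hlim (n x : ℕ) (hx : x ∈ Y.vertexSet) (hxn : x + 1 ≤ n) :
      (G n).1 x = (G (x + 1)).1 x := by
    induction n, hxn using Nat.le_induction with
    | base => rfl
    | succ n hn ih => rw [← hG n ⟨hx, hn⟩, ih]
  have hF (n : ℕ) : EmbedsOn Y X (Y.vertexSet ∩ Set.Iio n) fun x => (G (x + 1)).1 x :=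
    (G n).2.congr fun x hx => hlim n x hx.1 hx.2
  refine ⟨fun x => (G (x + 1)).1 x, fun x hx y hy hxy => ?_, fun s hs => ?_⟩
  · exact (hF (max x y + 1)).1 ⟨hx, Nat.lt_succ_of_le (le_max_left x y)⟩
      ⟨hy, Nat.lt_succ_of_le (le_max_right x y)⟩ hxy
  · exact (hF (s.sup id + 1)).2 s fun x hx =>
      ⟨hs hx, Nat.lt_succ_of_le (Finset.le_sup (f := id) hx)⟩

lemma vertexSet_induced {X : SComplex} {U : Set ℕ} (hU : U ⊆ X.vertexSet) :
    (X.induced U).vertexSet = U := by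
  ext x
  simpa [vertexSet, induced] using fun hx => hU hx

lemma EmbedsOn.isIso {Y X : SComplex} {f : ℕ → ℕ} (hf : EmbedsOn Y X Y.vertexSet f) :
    IsIso Y (X.induced (f '' Y.vertexSet)) f := by
  refine ⟨?_, fun s hs => (hf.2 s hs).trans ?_⟩
  · rw [vertexSet_induced (hf.mapsTo subset_rfl).image_subset]
    exact hf.1.bijOn_image
  · refine (and_iff_left ?_).symm
    rw [Finset.coe_image]
    exact Set.image_mono hs

end SComplex

/-- Every ample simplicial complex is universal. -/
theorem ample_universal (X : SComplex) (hX : X.IsAmple) : X.Universal := by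
  intro Y _
  obtain ⟨f, hf⟩ := SComplex.exists_embedsOn_vertexSet hX.2 Y
  exact ⟨f '' Y.vertexSet, (hf.mapsTo subset_rfl).image_subset, f, hf.isIso⟩
end

section
/- Let X be the simplicial complex with vertex set the positive integers ℕ = {1, 2, …} defined as follows, where p_k denotes the k-th prime (p_1 = 2, p_2 = 3, …): a pair a_0 < a_1 is a 1-dimensional simplex of X if and only if the p_{a_0}-th binary digit of a_1 is 1; and an increasing sequence of positive integers a_0 < a_1 < … < a_k (k ≥ 2) is a simplex of X if and only if all of its proper subsequences (obtained by erasing one or more elements) are simplexes of X and additionally the (p_{a_0} p_{a_1} ⋯ p_{a_{k−1}})-th binary digit of a_k is 1. Then X is a Rado complex. -/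
/-- `p k` is the `k`-th prime in the indexing of the paper: `p 1 = 2`, `p 2 = 3`, …. -/
noncomputable def nthPrime (k : ℕ) : ℕ := Nat.nth Nat.Prime (k - 1)

/-- The `N`-th binary digit of `m` is `1`. -/
def binDigitOne (N m : ℕ) : Prop := m / 2 ^ N % 2 = 1

/-- The explicit Rado complex of the paper.  Its vertices are the positive integers;
an increasing tuple `a₀ < a₁ < ⋯ < a_k` of positive integers (a nonempty finset `s`)
is a simplex iff for every sub-tuple `t ⊆ s` with at least two elements the
`(p_{t₀} p_{t₁} ⋯ p_{t_{k-1}})`-th binary digit of `max t` is `1` (the product being over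
all elements of `t` except its maximum).  Unfolding the recursion, this says precisely
that all proper subsequences of `s` are simplexes and the
`(p_{a₀} ⋯ p_{a_{k-1}})`-th binary digit of `a_k` is `1`. -/
def radoExplicit : SComplex where
  faces := {s : Finset ℕ | s.Nonempty ∧ (∀ a ∈ s, 0 < a) ∧
    ∀ t, t ⊆ s → ∀ h2 : 2 ≤ t.card,
      binDigitOne (∏ i ∈ t.erase (t.max' (Finset.card_pos.mp (by omega))), nthPrime i)
        (t.max' (Finset.card_pos.mp (by omega)))}
  nonempty_of_mem := fun s hs => hs.1
  down_closed := fun s hs t hts ht =>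
    ⟨ht, fun a ha => hs.2.1 a (hts ha), fun u hu h2 => hs.2.2 u (hu.trans hts) h2⟩

namespace SComplex

/-- A finite relation `g` is a partial isomorphism from `X` to `Y` if it is the graph of an
isomorphism between finite induced subcomplexes of `X` and `Y`. -/
structure IsPartialIso_s8 (X Y : SComplex) (g : Finset (ℕ × ℕ)) : Prop where
  fst_mem : ∀ p ∈ g, p.1 ∈ X.vertexSet
  snd_mem : ∀ p ∈ g, p.2 ∈ Y.vertexSet
  fst_eq_iff : ∀ p ∈ g, ∀ q ∈ g, p.1 = q.1 ↔ p.2 = q.2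
  image_mem_iff : ∀ h ⊆ g, h.image Prod.fst ∈ X.faces ↔ h.image Prod.snd ∈ Y.faces

lemma isPartialIso_empty_s8 (X Y : SComplex) : IsPartialIso_s8 X Y ∅ where
  fst_mem := by simp
  snd_mem := by simp
  fst_eq_iff := by simp
  image_mem_iff h hh := by
    rw [Finset.subset_empty.mp hh]
    exact ⟨fun h => absurd (X.nonempty_of_mem _ h) (by simp),
      fun h => absurd (Y.nonempty_of_mem _ h) (by simp)⟩

lemma IsPartialIso_s8.swap {X Y : SComplex} {g : Finset (ℕ × ℕ)} (hg : IsPartialIso_s8 X Y g) :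
    IsPartialIso_s8 Y X (g.image Prod.swap) where
  fst_mem := by
    intro p hp
    obtain ⟨q, hq, rfl⟩ := Finset.mem_image.mp hp
    exact hg.snd_mem q hq
  snd_mem := by
    intro p hp
    obtain ⟨q, hq, rfl⟩ := Finset.mem_image.mp hp
    exact hg.fst_mem q hq
  fst_eq_iff := by
    intro p hp p' hp'
    obtain ⟨q, hq, rfl⟩ := Finset.mem_image.mp hp
    obtain ⟨q', hq', rfl⟩ := Finset.mem_image.mp hp'
    exact (hg.fst_eq_iff q hq q' hq').symm
  image_mem_iff := by
    intro h hh
    obtain ⟨k, hk, rfl⟩ := Finset.subset_image_iff.mp hh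
    simpa [Finset.image_image, Function.comp_def] using (hg.image_mem_iff k hk).symm

/-- Partial isomorphisms into an ample complex can be extended by one more vertex. -/
lemma IsPartialIso_s8.exists_extension {X Y : SComplex} (hY : AmpleProp Y) {g : Finset (ℕ × ℕ)}
    (hg : IsPartialIso_s8 X Y g) {x : ℕ} (hx : x ∈ X.vertexSet) :
    ∃ g', g ⊆ g' ∧ IsPartialIso_s8 X Y g' ∧ ∃ y, (x, y) ∈ g' := by
  by_cases hxg : ∃ y, (x, y) ∈ g
  · exact ⟨g, subset_rfl, hg, hxg⟩
  let A : SComplex :=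
    { faces := {s | s.Nonempty ∧ ∃ h ⊆ g, h.image Prod.snd = s ∧
        insert x (h.image Prod.fst) ∈ X.faces}
      nonempty_of_mem := fun s hs => hs.1
      down_closed := by
        rintro s ⟨-, h, hhg, rfl, hX⟩ t hts ht
        obtain ⟨k, hk, rfl⟩ := Finset.subset_image_iff.mp hts
        refine ⟨ht, k, (Finset.coe_subset.mp hk).trans hhg, rfl, X.down_closed _ hX _ ?_
          (Finset.insert_nonempty _ _)⟩
        exact Finset.insert_subset_insert _ (Finset.image_subset_image (Finset.coe_subset.mp hk)) }
  obtain ⟨y, ⟨hyY, hyg⟩, hlink⟩ := hY (↑(g.image Prod.snd)) (Finset.finite_toSet _)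
    (by
      intro v hv
      obtain ⟨p, hp, rfl⟩ := Finset.mem_image.mp (Finset.mem_coe.mp hv)
      exact hg.snd_mem p hp) A
    (by
      rintro s ⟨hs, h, hhg, rfl, hX⟩
      refine ⟨(hg.image_mem_iff h hhg).mp (X.down_closed _ hX _ (Finset.subset_insert _ _) ?_), ?_⟩
      · simpa using hs
      · exact Finset.coe_subset.mpr (Finset.image_subset_image hhg))
  have hxg' : ∀ p ∈ g, p.1 ≠ x := fun p hp h => hxg ⟨p.2, h ▸ hp⟩
  have hyg' : ∀ p ∈ g, p.2 ≠ y := fun p hp h =>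
    hyg (Finset.mem_coe.mpr (Finset.mem_image.mpr ⟨p, hp, h⟩))
  have hface : ∀ h ⊆ g, insert x (h.image Prod.fst) ∈ X.faces ↔
      insert y (h.image Prod.snd) ∈ Y.faces := by
    intro h hhg
    rcases h.eq_empty_or_nonempty with rfl | hne
    · exact iff_of_true hx hyY
    have key := Set.ext_iff.mp hlink (h.image Prod.snd)
    constructor
    · intro hX
      exact (key.mpr ⟨hne.image _, h, hhg, rfl, hX⟩).1.2.2
    · intro hins
      have hYf : h.image Prod.snd ∈ Y.faces :=
        Y.down_closed _ hins _ (Finset.subset_insert _ _) (hne.image _)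
      have hy : y ∉ h.image Prod.snd := by
        intro hy
        obtain ⟨p, hp, hpy⟩ := Finset.mem_image.mp hy
        exact hyg' p (hhg hp) hpy
      obtain ⟨-, k, hkg, hkh, hX⟩ := key.mp ⟨⟨hYf, hy, hins⟩, hYf,
        Finset.coe_subset.mpr (Finset.image_subset_image hhg)⟩
      have hinj : Set.InjOn Prod.snd (↑g : Set (ℕ × ℕ)) := fun p hp q hq hpq =>
        Prod.ext ((hg.fst_eq_iff p hp q hq).mpr hpq) hpq
      have hkh' : k = h := by
        apply Finset.coe_injective
        apply (hinj.image_eq_image_iff (Finset.coe_subset.mpr hkg) (Finset.coe_subset.mpr hhg)).mp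
        rw [← Finset.coe_image, ← Finset.coe_image, hkh]
      rwa [← hkh']
  refine ⟨insert (x, y) g, Finset.subset_insert _ _, ⟨?_, ?_, ?_, ?_⟩, y,
    Finset.mem_insert_self _ _⟩
  · intro p hp
    rcases Finset.mem_insert.mp hp with rfl | hp
    exacts [hx, hg.fst_mem p hp]
  · intro p hp
    rcases Finset.mem_insert.mp hp with rfl | hp
    exacts [hyY, hg.snd_mem p hp]
  · intro p hp q hq
    rcases Finset.mem_insert.mp hp with rfl | hp <;> rcases Finset.mem_insert.mp hq with rfl | hq
    · simp
    · exact iff_of_false (hxg' q hq).symm (hyg' q hq).symm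
    · exact iff_of_false (hxg' p hp) (hyg' p hp)
    · exact hg.fst_eq_iff p hp q hq
  · intro h hh
    by_cases hmem : (x, y) ∈ h
    · rw [← Finset.insert_erase hmem, Finset.image_insert, Finset.image_insert]
      exact hface _ (Finset.subset_insert_iff.mp hh)
    · exact hg.image_mem_iff h ((Finset.subset_insert_iff_of_notMem hmem).mp hh)

/-- If partial isomorphisms extend to any vertex of `X`, and their images extend to any vertex
in `B`, then every partial isomorphism extends to an embedding of `X` whose range contains `B`. -/
lemma IsPartialIso_s8.exists_embedding {X Y : SComplex} {g₀ : Finset (ℕ × ℕ)}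
    (hg₀ : IsPartialIso_s8 X Y g₀) (B : Set ℕ)
    (forth : ∀ g, IsPartialIso_s8 X Y g → ∀ x ∈ X.vertexSet,
      ∃ g', g ⊆ g' ∧ IsPartialIso_s8 X Y g' ∧ ∃ y, (x, y) ∈ g')
    (back : ∀ g, IsPartialIso_s8 X Y g → ∀ y ∈ B,
      ∃ g', g ⊆ g' ∧ IsPartialIso_s8 X Y g' ∧ ∃ x, (x, y) ∈ g') :
    ∃ f : ℕ → ℕ, Set.MapsTo f X.vertexSet Y.vertexSet ∧ Set.InjOn f X.vertexSet ∧
      B ⊆ f '' X.vertexSet ∧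
      (∀ s : Finset ℕ, (↑s : Set ℕ) ⊆ X.vertexSet → (s ∈ X.faces ↔ s.image f ∈ Y.faces)) ∧
      ∀ p ∈ g₀, f p.1 = p.2 := by
  let P := {g // IsPartialIso_s8 X Y g}
  let D : ℕ ⊕ ℕ → Order.Cofinal P := Sum.elim
    (fun x => ⟨{g | x ∈ X.vertexSet → ∃ y, (x, y) ∈ g.1}, by
      rintro ⟨g, hg⟩
      by_cases hx : x ∈ X.vertexSet
      · obtain ⟨g', hle, hg', h⟩ := forth g hg x hx
        exact ⟨⟨g', hg'⟩, fun _ => h, hle⟩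
      · exact ⟨⟨g, hg⟩, fun h => absurd h hx, le_rfl⟩⟩)
    (fun y => ⟨{g | y ∈ B → ∃ x, (x, y) ∈ g.1}, by
      rintro ⟨g, hg⟩
      by_cases hy : y ∈ B
      · obtain ⟨g', hle, hg', h⟩ := back g hg y hy
        exact ⟨⟨g', hg'⟩, fun _ => h, hle⟩
      · exact ⟨⟨g, hg⟩, fun h => absurd h hy, le_rfl⟩⟩)
  let I : Order.Ideal P := Order.idealOfCofinals ⟨g₀, hg₀⟩ D
  have hI : ∀ g ∈ I, ∀ h ∈ I, ∃ k ∈ I, g.1 ⊆ k.1 ∧ h.1 ⊆ k.1 := I.directed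
  have hdom : ∀ x, ∃ y, x ∈ X.vertexSet → ∃ g ∈ I, (x, y) ∈ g.1 := by
    intro x
    by_cases hx : x ∈ X.vertexSet
    · obtain ⟨g, hgD, hgI⟩ := Order.cofinal_meets_idealOfCofinals ⟨g₀, hg₀⟩ D (Sum.inl x)
      obtain ⟨y, hy⟩ := hgD hx
      exact ⟨y, fun _ => ⟨g, hgI, hy⟩⟩
    · exact ⟨0, fun h => absurd h hx⟩
  choose f hf using hdom
  have hfin : ∀ s : Finset ℕ, (↑s : Set ℕ) ⊆ X.vertexSet → ∃ g ∈ I, ∀ x ∈ s, (x, f x) ∈ g.1 := by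
    intro s
    induction s using Finset.induction_on with
    | empty => exact fun _ => ⟨⟨g₀, hg₀⟩, Order.mem_idealOfCofinals _ _, by simp⟩
    | insert a s ha ih =>
      intro hs
      rw [Finset.coe_insert, Set.insert_subset_iff] at hs
      obtain ⟨g, hgI, hg⟩ := ih hs.2
      obtain ⟨h, hhI, hh⟩ := hf a hs.1
      obtain ⟨k, hkI, hgk, hhk⟩ := hI g hgI h hhI
      refine ⟨k, hkI, fun x hx => ?_⟩
      rcases Finset.mem_insert.mp hx with rfl | hx
      exacts [hhk hh, hgk (hg x hx)]
  have huniq : ∀ g ∈ I, ∀ p ∈ g.1, f p.1 = p.2 := by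
    intro g hgI p hp
    obtain ⟨h, hhI, hh⟩ := hf p.1 (g.2.fst_mem p hp)
    obtain ⟨k, -, hgk, hhk⟩ := hI g hgI h hhI
    exact (k.2.fst_eq_iff _ (hhk hh) _ (hgk hp)).mp rfl
  refine ⟨f, ?_, ?_, ?_, ?_, huniq _ (Order.mem_idealOfCofinals _ _)⟩
  · intro x hx
    obtain ⟨g, -, hg⟩ := hf x hx
    exact g.2.snd_mem _ hg
  · intro x hx x' hx' hxx'
    obtain ⟨g, hgI, hg⟩ := hf x hx
    obtain ⟨h, hhI, hh⟩ := hf x' hx'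
    obtain ⟨k, -, hgk, hhk⟩ := hI g hgI h hhI
    exact (k.2.fst_eq_iff _ (hgk hg) _ (hhk hh)).mpr hxx'
  · intro y hy
    obtain ⟨g, hgD, hgI⟩ := Order.cofinal_meets_idealOfCofinals ⟨g₀, hg₀⟩ D (Sum.inr y)
    obtain ⟨x, hx⟩ := hgD hy
    exact ⟨x, g.2.fst_mem _ hx, huniq g hgI _ hx⟩
  · intro s hs
    obtain ⟨g, -, hg⟩ := hfin s hs
    have := g.2.image_mem_iff (s.image fun x => (x, f x)) (Finset.image_subset_iff.mpr hg)
    simpa [Finset.image_image, Function.comp_def] using this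

lemma AmpleProp.universal {X : SComplex} (hX : AmpleProp X) : Universal X := by
  intro Y _
  obtain ⟨f, hmaps, hinj, -, hface, -⟩ := (isPartialIso_empty_s8 Y X).exists_embedding ∅
    (fun g hg x hx => hg.exists_extension hX hx) (by simp)
  refine ⟨f '' Y.vertexSet, hmaps.image_subset, f, ?_, ?_⟩
  · rw [vertexSet_induced hmaps.image_subset]
    exact hinj.bijOn_image
  · intro s hs
    rw [hface s hs]
    refine ⟨fun h => ⟨h, ?_⟩, fun h => h.1⟩
    rw [Finset.coe_image]
    exact Set.image_mono hs

lemma AmpleProp.homogeneous {X : SComplex} (hX : AmpleProp X) : Homogeneous X := by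
  intro U U' hUfin _ hU hU' f hf
  obtain ⟨hbij, hface⟩ := hf
  rw [vertexSet_induced hU, vertexSet_induced hU'] at hbij
  rw [vertexSet_induced hU] at hface
  obtain ⟨S, rfl⟩ := hUfin.exists_finset_coe
  have hg : IsPartialIso_s8 X X (S.image fun x => (x, f x)) := by
    refine ⟨?_, ?_, ?_, ?_⟩
    · simp only [Finset.forall_mem_image]
      exact fun x hx => hU hx
    · simp only [Finset.forall_mem_image]
      exact fun x hx => hU' (hbij.mapsTo hx)
    · simp only [Finset.forall_mem_image]
      exact fun x hx y hy => (hbij.injOn.eq_iff hx hy).symm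
    · intro h hh
      obtain ⟨t, ht, rfl⟩ := Finset.subset_image_iff.mp hh
      have hsub : (↑(t.image f) : Set ℕ) ⊆ U' := by
        rw [Finset.coe_image]
        exact (Set.image_mono ht).trans hbij.mapsTo.image_subset
      have := hface t ht
      have hiff : t ∈ X.faces ↔ t.image f ∈ X.faces :=
        ⟨fun h => (this.mp ⟨h, ht⟩).1, fun h => (this.mpr ⟨h, hsub⟩).1⟩
      simpa [Finset.image_image, Function.comp_def] using hiff
  obtain ⟨F, hmaps, hinj, hsurj, hF, hext⟩ := hg.exists_embedding X.vertexSet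
    (fun g hg x hx => hg.exists_extension hX hx)
    (fun g hg y hy => by
      obtain ⟨g', hle, hg', x, hx⟩ := hg.swap.exists_extension hX hy
      refine ⟨g'.image Prod.swap, fun p hp => ?_, hg'.swap, x,
        Finset.mem_image.mpr ⟨_, hx, rfl⟩⟩
      exact Finset.mem_image.mpr ⟨p.swap, hle (Finset.mem_image_of_mem _ hp), p.swap_swap⟩)
  exact ⟨F, ⟨⟨hmaps, hinj, hsurj⟩, hF⟩,
    fun x hx => hext _ (Finset.mem_image_of_mem (fun x => (x, f x)) hx)⟩

end SComplex

lemma nthPrime_prime (k : ℕ) : (nthPrime k).Prime := Nat.prime_nth_prime _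

lemma nthPrime_injOn : Set.InjOn nthPrime (Set.Ioi 0) := by
  intro a ha b hb h
  have := Nat.nth_injective Nat.infinite_setOfPred_prime h
  simp only [Set.mem_Ioi] at ha hb
  omega

lemma image_nthPrime_eq_primeFactors_prod {s : Finset ℕ} (hs : ∀ a ∈ s, 0 < a) :
    s.image nthPrime = (∏ i ∈ s, nthPrime i).primeFactors := by
  rw [← Finset.prod_image (f := fun i => i) fun a ha b hb h =>
    nthPrime_injOn (hs a ha) (hs b hb) h]
  refine (Nat.primeFactors_prod fun p hp => ?_).symm
  obtain ⟨k, -, rfl⟩ := Finset.mem_image.mp hp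
  exact nthPrime_prime k

lemma eq_of_prod_nthPrime_eq {s t : Finset ℕ} (hs : ∀ a ∈ s, 0 < a) (ht : ∀ a ∈ t, 0 < a)
    (h : ∏ i ∈ s, nthPrime i = ∏ i ∈ t, nthPrime i) : s = t := by
  apply Finset.coe_injective
  apply (nthPrime_injOn.image_eq_image_iff hs ht).mp
  rw [← Finset.coe_image, ← Finset.coe_image, image_nthPrime_eq_primeFactors_prod hs,
    image_nthPrime_eq_primeFactors_prod ht, h]

lemma exists_gt_forall_binDigitOne_iff (M : ℕ) (Q : ℕ → Prop) :
    ∃ v, M < v ∧ ∀ N < M, binDigitOne N v ↔ Q N := by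
  classical
  refine ⟨Nat.ofBits fun i : Fin (M + 1) => decide (i.1 = M ∨ Q i.1), ?_, ?_⟩
  · refine Nat.lt_two_pow_self.trans_le (Nat.ge_two_pow_of_testBit ?_)
    rw [Nat.testBit_ofBits_lt _ _ M.lt_succ_self]
    simp
  · intro N hN
    have := Nat.testBit_ofBits_lt (fun i : Fin (M + 1) => decide (i.1 = M ∨ Q i.1)) N (by omega)
    rw [Nat.testBit_eq_decide_div_mod_eq, decide_eq_decide] at this
    simpa [binDigitOne, hN.ne] using this

lemma exists_gt_forall_prod_binDigitOne_iff {S : Finset ℕ} (hS : ∀ a ∈ S, 0 < a)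
    (Q : Finset ℕ → Prop) :
    ∃ v, (∀ a ∈ S, a < v) ∧ ∀ s ⊆ S, binDigitOne (∏ i ∈ s, nthPrime i) v ↔ Q s := by
  obtain ⟨v, hv, hQ⟩ := exists_gt_forall_binDigitOne_iff
    (S.sup id + (∏ i ∈ S, nthPrime i) + 1)
    (fun N => ∃ s ⊆ S, ∏ i ∈ s, nthPrime i = N ∧ Q s)
  refine ⟨v, fun a ha => ?_, fun s hs => ?_⟩
  · have : a ≤ S.sup id := Finset.le_sup (f := id) ha
    omega
  · have hle : ∏ i ∈ s, nthPrime i ≤ ∏ i ∈ S, nthPrime i :=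
      Finset.prod_le_prod_of_subset_of_one_le' hs fun i _ _ => (nthPrime_prime i).one_le
    rw [hQ _ (by omega)]
    constructor
    · rintro ⟨t, ht, h, hQt⟩
      rwa [← eq_of_prod_nthPrime_eq (fun a ha => hS a (ht ha)) (fun a ha => hS a (hs ha)) h]
    · exact fun h => ⟨s, hs, rfl, h⟩

lemma mem_radoExplicit_vertexSet {v : ℕ} : v ∈ radoExplicit.vertexSet ↔ 0 < v := by
  simp only [SComplex.vertexSet, radoExplicit, Set.mem_ofPred_eq]
  refine ⟨fun h => h.2.1 v (Finset.mem_singleton_self v), fun h => ⟨by simp, by simpa, ?_⟩⟩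
  intro t ht h2
  have := Finset.card_le_card ht
  rw [Finset.card_singleton] at this
  omega

lemma insert_mem_radoExplicit_iff {s : Finset ℕ} {v : ℕ} (hs : s ∈ radoExplicit.faces)
    (hv : ∀ a ∈ s, a < v) :
    insert v s ∈ radoExplicit.faces ↔
      ∀ t ⊆ s, t.Nonempty → binDigitOne (∏ i ∈ t, nthPrime i) v := by
  have hmax : ∀ t ⊆ s, ∀ h, (insert v t).max' h = v := fun t ht h =>
    le_antisymm (Finset.max'_le _ _ _ fun a ha => by
      rcases Finset.mem_insert.mp ha with rfl | ha
      exacts [le_rfl, (hv a (ht ha)).le]) (Finset.le_max' _ _ (Finset.mem_insert_self _ _))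
  have hvs : v ∉ s := fun h => lt_irrefl _ (hv v h)
  constructor
  · rintro ⟨-, -, h⟩ t ht hne
    have hvt : v ∉ t := fun h => hvs (ht h)
    have := h (insert v t) (Finset.insert_subset_insert v ht) (by
      rw [Finset.card_insert_of_notMem hvt]
      have := hne.card_pos
      omega)
    simpa only [hmax t ht, Finset.erase_insert hvt] using this
  · intro h
    refine ⟨Finset.insert_nonempty _ _, ?_, ?_⟩
    · intro a ha
      rcases Finset.mem_insert.mp ha with rfl | ha
      · obtain ⟨b, hb⟩ := hs.1
        exact (Nat.zero_le b).trans_lt (hv b hb)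
      · exact hs.2.1 a ha
    · intro t ht h2
      by_cases hvt : v ∈ t
      · obtain ⟨u, hvu, rfl⟩ : ∃ u, v ∉ u ∧ insert v u = t :=
          ⟨t.erase v, Finset.notMem_erase v t, Finset.insert_erase hvt⟩
        have hus : u ⊆ s := by
          rw [Finset.subset_insert_iff, Finset.erase_insert hvu] at ht
          exact ht
        simp only [hmax u hus, Finset.erase_insert hvu]
        refine h u hus (Finset.card_pos.mp ?_)
        rw [Finset.card_insert_of_notMem hvu] at h2
        omega
      · exact hs.2.2 t ((Finset.subset_insert_iff_of_notMem hvt).mp ht) h2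

lemma radoExplicit_ampleProp : radoExplicit.AmpleProp := by
  intro U hU hUV A hA
  obtain ⟨S, rfl⟩ := hU.exists_finset_coe
  have hS : ∀ a ∈ S, 0 < a := fun a ha => mem_radoExplicit_vertexSet.mp (hUV ha)
  obtain ⟨v, hv, hdigit⟩ := exists_gt_forall_prod_binDigitOne_iff
    (S := insert 1 S) (by simpa using hS) (· ∈ A.faces)
  have hvS : ∀ a ∈ S, a < v := fun a ha => hv a (Finset.mem_insert_of_mem ha)
  refine ⟨v, ⟨mem_radoExplicit_vertexSet.mpr
    (Nat.one_pos.trans (hv 1 (Finset.mem_insert_self 1 S))), fun h => lt_irrefl _ (hvS v h)⟩, ?_⟩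
  have hins : ∀ s ∈ radoExplicit.faces, s ⊆ S → (insert v s ∈ radoExplicit.faces ↔
      s ∈ A.faces) := by
    intro s hs hsS
    rw [insert_mem_radoExplicit_iff hs fun a ha => hvS a (hsS ha)]
    have hsub : ∀ t ⊆ s, t ⊆ insert 1 S := fun t ht =>
      (ht.trans hsS).trans (Finset.subset_insert 1 S)
    exact ⟨fun h => (hdigit s (hsub s subset_rfl)).mp (h s subset_rfl hs.1),
      fun h t ht hne => (hdigit t (hsub t ht)).mpr (A.down_closed s h t ht hne)⟩
  ext s
  constructor
  · rintro ⟨⟨-, -, h⟩, hs, hsS⟩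
    exact (hins s hs (Finset.coe_subset.mp hsS)).mp h
  · intro h
    obtain ⟨hs, hsS⟩ := hA h
    have hsS' : s ⊆ S := Finset.coe_subset.mp hsS
    exact ⟨⟨hs, fun hvs => lt_irrefl _ (hvS v (hsS' hvs)), (hins s hs hsS').mpr h⟩, hs, hsS⟩

/-- The explicit complex above is a Rado complex. -/
theorem radoExplicit_isRado : radoExplicit.IsRado :=
  ⟨Set.to_countable _, radoExplicit_ampleProp.universal, radoExplicit_ampleProp.homogeneous⟩
end
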